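/- arXiv:1311.0599 — 4 statements merged into one kernel-verified Lean document; each statement's English description precedes it below -/
import Mathlib

section
/- For any positive integers n and m, the number of conjugacy classes of the unitary group U(n) consisting of elements x with x^m = 1 equals the binomial coefficient C(n+m-1, m-1). -/
open Matrix

/-- A diagonalizable endomorphism preserving the inner product has an orthonormal eigenbasis. -/
theorem exists_orthonormalBasis_eigenvectors {V : Type*} [NormedAddCommGroup V]
    [InnerProductSpace ℂ V] [FiniteDimensional ℂ V] {n : ℕ} (hn : Module.finrank ℂ V = n)
    {T : Module.End ℂ V} (hT : ∀ x y, inner ℂ (T x) (T y) = inner ℂ x y)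
    (htop : ⨆ μ, T.eigenspace μ = ⊤) :
    ∃ (b : OrthonormalBasis (Fin n) ℂ V) (μ : Fin n → ℂ), ∀ i, T (b i) = μ i • b i := by
  classical
  have horth : OrthogonalFamily ℂ (fun μ : T.Eigenvalues => T.eigenspace (μ : ℂ))
      fun μ => (T.eigenspace (μ : ℂ)).subtypeₗᵢ := by
    rintro ⟨μ, hμ⟩ ⟨ν, hν⟩ hne ⟨v, hv⟩ ⟨w, hw⟩
    rw [Module.End.mem_eigenspace_iff] at hv hw
    change T v = μ • v at hv
    change T w = ν • w at hw
    change inner ℂ v w = 0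
    have h1 := hT v w
    have h2 := hT v v
    rw [hv, hw, inner_smul_left, inner_smul_right] at h1
    rw [hv, inner_smul_left, inner_smul_right] at h2
    by_contra h
    have hvv : inner ℂ v v ≠ 0 := by
      rw [inner_self_ne_zero]
      rintro rfl
      simp at h
    have e1 : starRingEnd ℂ μ * ν = 1 := mul_right_cancel₀ h (by rw [mul_assoc, h1, one_mul])
    have e2 : starRingEnd ℂ μ * μ = 1 := mul_right_cancel₀ hvv (by rw [mul_assoc, h2, one_mul])
    have e3 : μ = ν :=
      mul_left_cancel₀ (left_ne_zero_of_mul (e1.trans_ne one_ne_zero)) (e2.trans e1.symm)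
    exact hne (Subtype.ext e3)
  have hint : DirectSum.IsInternal fun μ : T.Eigenvalues => T.eigenspace (μ : ℂ) := by
    rw [horth.isInternal_iff, Submodule.orthogonal_eq_bot_iff, ← htop]
    exact iSup_ne_bot_subtype _
  exact ⟨hint.subordinateOrthonormalBasis hn horth,
    fun i => ((hint.subordinateOrthonormalBasisIndex hn i horth : T.Eigenvalues) : ℂ), fun i =>
      Module.End.mem_eigenspace_iff.1 (hint.subordinateOrthonormalBasis_subordinate hn i horth)⟩

theorem Module.End.isSemisimple_of_pow_eq_one {K V : Type*} [Field K] [CharZero K]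
    [AddCommGroup V] [Module K V] {T : Module.End K V} {m : ℕ} (hm : m ≠ 0) (hT : T ^ m = 1) :
    T.IsSemisimple := by
  refine Module.End.isSemisimple_of_squarefree_aeval_eq_zero (p := Polynomial.X ^ m - 1) ?_ ?_
  · exact ((Polynomial.X_pow_sub_one_separable_iff).2 (by exact_mod_cast hm)).squarefree
  · simp [hT]

theorem exists_perm_of_map_univ_eq {ι α : Type*} [Fintype ι] {g h : ι → α}
    (hgh : Finset.univ.val.map g = Finset.univ.val.map h) :
    ∃ σ : Equiv.Perm ι, g = h ∘ σ := by
  classical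
  have hcard (a : α) : Fintype.card {i // g i = a} = Fintype.card {i // h i = a} := by
    have := congrArg (Multiset.count a) hgh
    simp only [Multiset.count_map, eq_comm (a := a)] at this
    rw [Fintype.card_subtype, Fintype.card_subtype]
    exact this
  exact ⟨Equiv.ofFiberEquiv fun a => Fintype.equivOfCardEq (hcard a),
    funext fun i => (Equiv.ofFiberEquiv_map _ i).symm⟩

namespace Matrix.unitaryGroup

/-- A unitary matrix of finite order is unitarily diagonalizable. -/
theorem exists_mul_eq_mul_diagonal {n m : ℕ} (hm : m ≠ 0) {A : unitaryGroup (Fin n) ℂ}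
    (hA : A ^ m = 1) :
    ∃ (U : unitaryGroup (Fin n) ℂ) (μ : Fin n → ℂ),
      (A : Matrix (Fin n) (Fin n) ℂ) * U = U * diagonal μ := by
  set T : Module.End ℂ (EuclideanSpace ℂ (Fin n)) := toEuclideanLin (A : Matrix _ _ ℂ) with hTdef
  have hTm : T ^ m = 1 := by
    have hAm : (A : Matrix (Fin n) (Fin n) ℂ) ^ m = 1 := congrArg Subtype.val hA
    rw [hTdef, ← toLpLin_pow, hAm, toLpLin_one]
    rfl
  have hT : ∀ x y, inner ℂ (T x) (T y) = inner ℂ x y := by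
    intro x y
    rw [← LinearMap.adjoint_inner_right, hTdef, ← Matrix.toEuclideanLin_conjTranspose_eq_adjoint]
    congr 1
    ext i
    have h : (A : Matrix (Fin n) (Fin n) ℂ)ᴴ * A = 1 := (mem_unitaryGroup_iff').1 A.2
    simp [Matrix.mulVec_mulVec, h]
  obtain ⟨b, μ, hb⟩ := exists_orthonormalBasis_eigenvectors (finrank_euclideanSpace_fin) hT
    (Module.End.isSemisimple_of_pow_eq_one hm hTm).iSup_eigenspace_eq_top
  refine ⟨⟨_, (EuclideanSpace.basisFun (Fin n) ℂ).toMatrix_orthonormalBasis_mem_unitary b⟩, μ, ?_⟩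
  ext i j
  have := congrArg (fun v => v i) (hb j)
  simp only [hTdef, toLpLin_apply] at this
  rw [mul_diagonal]
  simpa [Matrix.mul_apply, Matrix.mulVec, dotProduct, Module.Basis.toMatrix_apply, mul_comm]
    using this

variable {ι : Type*} [Fintype ι] [DecidableEq ι] {m : ℕ} [NeZero m]

/-- The diagonal unitary matrix with the given roots of unity on the diagonal. -/
noncomputable def diagonalRootsOfUnity (g : ι → rootsOfUnity m ℂ) : unitaryGroup ι ℂ :=
  ⟨diagonal fun i => ((g i : ℂˣ) : ℂ), by
    rw [mem_unitaryGroup_iff, star_eq_conjTranspose, diagonal_conjTranspose, diagonal_mul_diagonal,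
      ← diagonal_one]
    congr 1
    ext i
    simp [Complex.mul_conj', Complex.norm_eq_one_of_mem_rootsOfUnity (g i).2]⟩

theorem diagonalRootsOfUnity_pow (g : ι → rootsOfUnity m ℂ) : diagonalRootsOfUnity g ^ m = 1 := by
  refine Subtype.ext ?_
  change (diagonal fun i => ((g i : ℂˣ) : ℂ)) ^ m = 1
  rw [diagonal_pow, ← diagonal_one]
  congr 1
  ext i
  exact (mem_rootsOfUnity' m _).1 (g i).2

theorem isConj_diagonalRootsOfUnity_iff {g h : ι → rootsOfUnity m ℂ} :
    IsConj (diagonalRootsOfUnity g) (diagonalRootsOfUnity h) ↔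
      Finset.univ.val.map g = Finset.univ.val.map h := by
  constructor
  · intro hc
    obtain ⟨U, hU⟩ := isConj_iff.1 hc
    have hcoe : Function.Injective fun z : rootsOfUnity m ℂ => ((z : ℂˣ) : ℂ) :=
      Units.val_injective.comp Subtype.val_injective
    refine Multiset.map_injective hcoe ?_
    have hroots : ∀ f : ι → ℂ, (diagonal f).charpoly.roots = Finset.univ.val.map f := by
      intro f
      rw [charpoly_diagonal, ← Polynomial.roots_multiset_prod_X_sub_C (Finset.univ.val.map f),
        Multiset.map_map]
      rfl
    simp only [Multiset.map_map]
    refine (hroots _).symm.trans (Eq.trans ?_ (hroots _))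
    have hU' : (U : Matrix ι ι ℂ) * diagonal (fun i => ((g i : ℂˣ) : ℂ)) *
        (star U : Matrix ι ι ℂ) = diagonal (fun i => ((h i : ℂˣ) : ℂ)) := congrArg Subtype.val hU
    have h1 : (star U : Matrix ι ι ℂ) * U = 1 := (mem_unitaryGroup_iff').1 U.2
    congr 1
    change (diagonal (fun i => ((g i : ℂˣ) : ℂ))).charpoly =
      (diagonal (fun i => ((h i : ℂˣ) : ℂ))).charpoly
    rw [← hU', charpoly_mul_comm, ← mul_assoc, h1, one_mul]
  · intro hgh
    obtain ⟨σ, rfl⟩ := exists_perm_of_map_univ_eq hgh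
    let P : unitaryGroup ι ℂ := ⟨(1 : Matrix ι ι ℂ).submatrix σ id, by
      rw [mem_unitaryGroup_iff', star_eq_conjTranspose, conjTranspose_submatrix,
        conjTranspose_one, submatrix_mul_equiv]
      simp⟩
    refine IsConj.symm (isConj_iff.2 ⟨P, ?_⟩)
    rw [mul_inv_eq_iff_eq_mul]
    refine Subtype.ext ?_
    change (1 : Matrix ι ι ℂ).submatrix σ id * diagonal _ =
      diagonal _ * (1 : Matrix ι ι ℂ).submatrix σ id
    ext i j
    by_cases hij : σ i = j <;> simp [hij, one_apply]

theorem exists_isConj_diagonalRootsOfUnity {n : ℕ} {A : unitaryGroup (Fin n) ℂ}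
    (hA : A ^ m = 1) :
    ∃ g : Fin n → rootsOfUnity m ℂ, IsConj (diagonalRootsOfUnity g) A := by
  obtain ⟨U, μ, hU⟩ := exists_mul_eq_mul_diagonal (NeZero.ne m) hA
  have hD : ((U⁻¹ * A * U : unitaryGroup (Fin n) ℂ) : Matrix (Fin n) (Fin n) ℂ) = diagonal μ := by
    have h1 : (star U : Matrix (Fin n) (Fin n) ℂ) * U = 1 := (mem_unitaryGroup_iff').1 U.2
    change (star U : Matrix (Fin n) (Fin n) ℂ) * A * U = _
    rw [mul_assoc, hU, ← mul_assoc, h1, one_mul]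
  have hpow : (U⁻¹ * A * U) ^ m = 1 := by
    simpa [hA] using conj_pow (a := U⁻¹) (b := A) (i := m)
  have hμ : ∀ i, μ i ^ m = 1 := by
    intro i
    have h2 : (diagonal μ) ^ m = 1 := by rw [← hD]; exact congrArg Subtype.val hpow
    rw [diagonal_pow] at h2
    simpa using congrFun (congrFun h2 i) i
  refine ⟨fun i => rootsOfUnity.mkOfPowEq (μ i) (hμ i), isConj_iff.2 ⟨U, ?_⟩⟩
  have : diagonalRootsOfUnity (fun i => rootsOfUnity.mkOfPowEq (μ i) (hμ i)) = U⁻¹ * A * U :=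
    Subtype.ext (by rw [hD]; rfl)
  rw [this]
  group

end Matrix.unitaryGroup

/-- For any positive integers `n` and `m`, the number of conjugacy classes of the unitary
group `U(n)` consisting of elements `x` with `x ^ m = 1` equals `C(n + m - 1, m - 1)`. -/
theorem stmt_0 (n m : ℕ) (hn : 0 < n) (hm : 0 < m) :
    {c : ConjClasses (Matrix.unitaryGroup (Fin n) ℂ) | ∀ x ∈ c.carrier, x ^ m = 1}.ncard
      = Nat.choose (n + m - 1) (m - 1) := by
  have : NeZero m := ⟨hm.ne'⟩
  have henum : ∀ s : Sym (rootsOfUnity m ℂ) n,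
      ∃ g : Fin n → rootsOfUnity m ℂ, Finset.univ.val.map g = s := by
    rintro ⟨s, hs⟩
    induction s using Quotient.inductionOn with
    | h l =>
      obtain rfl : l.length = n := hs
      exact ⟨l.get, by simp [Fin.univ_val_map]⟩
  choose enum henum using henum
  let F (s : Sym (rootsOfUnity m ℂ) n) : ConjClasses (Matrix.unitaryGroup (Fin n) ℂ) :=
    ConjClasses.mk (unitaryGroup.diagonalRootsOfUnity (enum s))
  have hF : Function.Injective F := fun s t hst => by
    have := unitaryGroup.isConj_diagonalRootsOfUnity_iff.1 (ConjClasses.mk_eq_mk_iff_isConj.1 hst)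
    rw [henum, henum] at this
    exact Subtype.ext this
  have hrange : {c : ConjClasses (Matrix.unitaryGroup (Fin n) ℂ) | ∀ x ∈ c.carrier, x ^ m = 1} =
      Set.range F := by
    ext c
    constructor
    · intro hc
      obtain ⟨A, rfl⟩ := ConjClasses.exists_rep c
      obtain ⟨g, hg⟩ :=
        unitaryGroup.exists_isConj_diagonalRootsOfUnity (hc A ConjClasses.mem_carrier_mk)
      refine ⟨⟨Finset.univ.val.map g, by simp⟩, ConjClasses.mk_eq_mk_iff_isConj.2 ?_⟩
      exact (unitaryGroup.isConj_diagonalRootsOfUnity_iff.2 (henum _)).trans hg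
    · rintro ⟨s, rfl⟩ x hx
      obtain ⟨U, hU⟩ := isConj_iff.1
        (ConjClasses.mk_eq_mk_iff_isConj.1 (ConjClasses.mem_carrier_iff_mk_eq.1 hx))
      have h := unitaryGroup.diagonalRootsOfUnity_pow (enum s)
      rw [← hU, conj_pow, conj_eq_one_iff] at h
      exact h
  rw [hrange, ← Set.image_univ, Set.ncard_image_of_injective _ hF, Set.ncard_univ,
    Sym.natCard_sym_eq_choose, Complex.card_rootsOfUnity, add_comm m n]
  exact Nat.choose_symm_of_eq_add (by omega)
end

section
/- For positive integers p, q, s with gcd(p,q) = 1, the number N(SU(p),q,s) of conjugacy classes of the special unitary group SU(p) consisting of elements x with x^q = 1 and with exactly s distinct eigenvalues satisfies q · N(SU(p),q,s) = C(p-1, s-1) · C(q, s). -/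
open Matrix

/-- The special unitary group `SU(p)`, as a subgroup of the unitary group
`Matrix.unitaryGroup (Fin p) ℂ` consisting of the elements of determinant `1`. -/
noncomputable def SU (p : ℕ) : Subgroup (Matrix.unitaryGroup (Fin p) ℂ) where
  carrier := {x | (x : Matrix (Fin p) (Fin p) ℂ).det = 1}
  one_mem' := by simp
  mul_mem' := by
    intro a b ha hb
    simp only [Set.mem_setOf_eq, Matrix.UnitaryGroup.mul_val, Matrix.det_mul] at *
    rw [ha, hb, mul_one]
  inv_mem' := by
    intro a ha
    simp only [Set.mem_setOf_eq, Matrix.UnitaryGroup.inv_val, Matrix.star_eq_conjTranspose,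
      Matrix.det_conjTranspose] at *
    rw [ha]; simp

/-- `NSUs p m s` is the number of conjugacy classes of `SU(p)` all of whose elements `x`
satisfy `x ^ m = 1` and have exactly `s` distinct eigenvalues (the cardinality of the
spectrum of the underlying complex matrix). -/
noncomputable def NSUs (p m s : ℕ) : ℕ :=
  {c : ConjClasses (SU p) | ∀ x ∈ c.carrier, x ^ m = 1 ∧
      (spectrum ℂ ((x : Matrix.unitaryGroup (Fin p) ℂ) : Matrix (Fin p) (Fin p) ℂ)).ncard = s}.ncard

theorem exists_unitary_mul_diagonal {n : Type*} [Fintype n] [DecidableEq n]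
    (x : Matrix.unitaryGroup n ℂ) {q : ℕ} (hq : 0 < q) (hx : x ^ q = 1) :
    ∃ (u : Matrix.unitaryGroup n ℂ) (d : n → ℂ),
      (x : Matrix n n ℂ) * u = (u : Matrix n n ℂ) * diagonal d := by
  classical
  set A : Matrix n n ℂ := x.1
  set T : Module.End ℂ (EuclideanSpace ℂ n) := Matrix.toEuclideanLin A with hT
  have hTi : ∀ v w, inner ℂ (T v) (T w) = inner ℂ v w := by
    intro v w
    have hs : Aᴴ * A = 1 := Unitary.coe_star_mul_self x
    simp only [hT, EuclideanSpace.inner_eq_star_dotProduct, toLpLin_apply]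
    rw [star_mulVec, ← dotProduct_comm, ← dotProduct_mulVec, mulVec_mulVec, hs, one_mulVec,
      dotProduct_comm]
  have hAq : A ^ q = 1 := by simpa using congrArg Subtype.val hx
  have hTq : T ^ q = 1 := by
    have h := map_pow (Matrix.toLinAlgEquiv (PiLp.basisFun 2 ℂ n)) A q
    rw [hAq, map_one] at h
    exact h.symm
  have hss : T.IsSemisimple := by
    refine Module.End.isSemisimple_of_squarefree_aeval_eq_zero
      (p := (Polynomial.X ^ q - 1 : Polynomial ℂ)) ?_ ?_
    · exact (Polynomial.X_pow_sub_one_separable_iff.2 (by exact_mod_cast hq.ne')).squarefree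
    · simp [hTq]
  have hort : OrthogonalFamily ℂ (fun μ => T.eigenspace μ)
      fun μ => (T.eigenspace μ).subtypeₗᵢ := by
    rintro μ ν hμν ⟨v, hv⟩ ⟨w, hw⟩
    rw [Module.End.mem_eigenspace_iff] at hv hw
    by_cases hv0 : v = 0
    · simp [hv0]
    have h1 := hTi v v
    have h2 := hTi v w
    simp only [hv, hw, inner_smul_left, inner_smul_right] at h1 h2
    have hvv : inner ℂ v v ≠ (0 : ℂ) := by simpa using hv0
    have hμ : (starRingEnd ℂ) μ * μ = 1 := by
      apply mul_right_cancel₀ hvv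
      linear_combination h1
    have hμ0 : (starRingEnd ℂ) μ ≠ 0 := left_ne_zero_of_mul_eq_one hμ
    have : (ν - μ) * inner ℂ v w = 0 := by
      apply mul_left_cancel₀ hμ0
      linear_combination h2 - inner ℂ v w * hμ
    exact (mul_eq_zero.1 this).resolve_left (sub_ne_zero.2 hμν.symm)
  have hort' := hort.comp (γ := T.Eigenvalues) (f := Subtype.val) Subtype.coe_injective
  have hint : DirectSum.IsInternal fun μ : T.Eigenvalues => T.eigenspace μ := by
    refine hort'.isInternal_iff.2 ?_
    have : (⨆ μ : T.Eigenvalues, T.eigenspace μ) = ⊤ := by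
      refine Eq.trans ?_ hss.iSup_eigenspace_eq_top
      exact iSup_ne_bot_subtype fun μ => T.eigenspace μ
    rw [Submodule.orthogonal_eq_bot_iff]
    exact this
  have hn : Module.finrank ℂ (EuclideanSpace ℂ n) = Fintype.card n := finrank_euclideanSpace
  let b : OrthonormalBasis n ℂ (EuclideanSpace ℂ n) :=
    (hint.subordinateOrthonormalBasis hn hort').reindex (Fintype.equivOfCardEq (Fintype.card_fin _))
  have hb : ∀ i, ∃ μ : ℂ, T (b i) = μ • b i := by
    intro i
    simp only [b, OrthonormalBasis.reindex_apply]
    exact ⟨_, Module.End.mem_eigenspace_iff.1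
      (hint.subordinateOrthonormalBasis_subordinate hn _ hort')⟩
  choose d hd using hb
  refine ⟨⟨_, (EuclideanSpace.basisFun n ℂ).toMatrix_orthonormalBasis_mem_unitary b⟩, d, ?_⟩
  ext i j
  have := congrArg (fun v : EuclideanSpace ℂ n => v i) (hd j)
  simp only [hT, toLpLin_apply, mulVec, dotProduct] at this
  rw [mul_diagonal, mul_apply]
  simpa [Module.Basis.toMatrix_apply, mul_comm] using this

theorem exists_perm_comp_eq_of_map_univ_eq {ι β : Type*} [Fintype ι] {f g : ι → β}
    (h : Finset.univ.val.map f = Finset.univ.val.map g) : ∃ σ : Equiv.Perm ι, f ∘ σ = g := by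
  classical
  have hc : ∀ b, Nonempty ({i // g i = b} ≃ {i // f i = b}) := by
    intro b
    refine ⟨Fintype.equivOfCardEq ?_⟩
    have := congrArg (Multiset.count b) h
    rw [Multiset.count_map, Multiset.count_map] at this
    simp only [Fintype.card_subtype, Finset.card_def, Finset.filter_val, eq_comm (b := b)]
    exact this.symm
  let e := fun b => (hc b).some
  exact ⟨Equiv.ofFiberEquiv e, funext fun i => Equiv.ofFiberEquiv_map e i⟩

theorem charpoly_eq_of_mul_eq_mul {n : Type*} [Fintype n] [DecidableEq n] {A B : Matrix n n ℂ}
    (u : Matrix.unitaryGroup n ℂ) (h : A * u = (u : Matrix n n ℂ) * B) :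
    A.charpoly = B.charpoly := by
  have hu : (u : Matrix n n ℂ) * star (u : Matrix n n ℂ) = 1 := Unitary.coe_mul_star_self u
  have hu' : star (u : Matrix n n ℂ) * (u : Matrix n n ℂ) = 1 := Unitary.coe_star_mul_self u
  have : A = u * B * star (u : Matrix n n ℂ) := by rw [← h, mul_assoc, hu, mul_one]
  rw [this, charpoly_mul_comm, ← mul_assoc, hu', one_mul]

theorem roots_charpoly_diagonal {n : Type*} [Fintype n] [DecidableEq n] (d : n → ℂ) :
    (diagonal d).charpoly.roots = Finset.univ.val.map d := by
  rw [charpoly_diagonal, Polynomial.roots_prod _ _ (by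
    simp [Finset.prod_ne_zero_iff, Polynomial.X_sub_C_ne_zero])]
  simp

theorem exists_SU_mul_diagonal {p : ℕ} (hp : 0 < p) (x : Matrix.unitaryGroup (Fin p) ℂ) {q : ℕ}
    (hq : 0 < q) (hx : x ^ q = 1) (d : Fin p → ℂ)
    (hd : (x : Matrix (Fin p) (Fin p) ℂ).charpoly.roots = Finset.univ.val.map d) :
    ∃ u : SU p, (x : Matrix (Fin p) (Fin p) ℂ) * (u : Matrix.unitaryGroup (Fin p) ℂ) =
      ((u : Matrix.unitaryGroup (Fin p) ℂ) : Matrix (Fin p) (Fin p) ℂ) * diagonal d := by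
  obtain ⟨u, e, hu⟩ := exists_unitary_mul_diagonal x hq hx
  rw [charpoly_eq_of_mul_eq_mul u hu, roots_charpoly_diagonal] at hd
  obtain ⟨σ, rfl⟩ := exists_perm_comp_eq_of_map_univ_eq hd
  set v : Matrix (Fin p) (Fin p) ℂ := u.1.submatrix id σ with hv
  have hv1 : v * star v = 1 := by
    rw [star_eq_conjTranspose, hv, conjTranspose_submatrix, submatrix_mul_equiv,
      ← star_eq_conjTranspose, submatrix_id_id]
    exact Unitary.coe_mul_star_self u
  have hdet : v.det * star v.det = 1 := by
    rw [← det_conjTranspose, ← star_eq_conjTranspose, ← det_mul, hv1, det_one]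
  obtain ⟨c, hc⟩ := IsAlgClosed.exists_pow_nat_eq (star v.det) hp
  have hcn : c * star c = 1 := by
    have h1 : ‖star v.det‖ = 1 := by
      have := congrArg norm hdet
      rw [norm_mul, norm_star, norm_one] at this
      rw [norm_star]
      nlinarith [norm_nonneg v.det]
    have h2 : ‖c‖ = 1 := by
      rw [← hc, norm_pow] at h1
      exact (pow_eq_one_iff_of_nonneg (norm_nonneg c) hp.ne').1 h1
    have := Complex.mul_conj' c
    rw [h2] at this
    simpa using this
  have hw : c • v ∈ Matrix.unitaryGroup (Fin p) ℂ := by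
    rw [mem_unitaryGroup_iff, star_smul, smul_mul_smul_comm, hv1, hcn, one_smul]
  refine ⟨⟨⟨c • v, hw⟩, ?_⟩, ?_⟩
  · change (c • v).det = 1
    rw [det_smul, Fintype.card_fin, hc, mul_comm, hdet]
  · change x.1 * (c • v) = (c • v) * diagonal (e ∘ σ)
    rw [mul_smul_comm, smul_mul_assoc]
    congr 1
    ext i j
    have := congrFun (congrFun hu i) (σ j)
    rw [mul_diagonal] at this ⊢
    simpa [hv, mul_apply] using this

theorem ncard_multiset_toFinset_eq {α : Type*} [DecidableEq α] {p : ℕ} (hp : 0 < p)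
    {S : Finset α} (hS : 0 < S.card) :
    {m : Multiset α | m.card = p ∧ m.toFinset = S}.ncard = (p - 1).choose (S.card - 1) := by
  rcases lt_or_ge p S.card with hlt | hle
  · rw [Nat.choose_eq_zero_of_lt (by omega)]
    refine Eq.trans (congrArg Set.ncard (Set.eq_empty_of_forall_notMem ?_)) (Set.ncard_empty _)
    rintro m ⟨rfl, rfl⟩
    exact absurd (Multiset.toFinset_card_le m) (by omega)
  · have hcard : Nat.card (Sym S (p - S.card)) = (p - 1).choose (S.card - 1) := by
      rw [Nat.card_eq_fintype_card, Sym.card_sym_eq_choose, Fintype.card_coe,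
        show S.card + (p - S.card) - 1 = p - 1 by omega,
        show p - S.card = p - 1 - (S.card - 1) by omega, Nat.choose_symm (by omega)]
    rw [← hcard, ← Set.ncard_univ]
    symm
    refine Set.ncard_congr (fun m _ => (m : Multiset S).map Subtype.val + S.val) ?_ ?_ ?_
    · intro m _
      constructor
      · simpa using Nat.sub_add_cancel hle
      · ext a
        simp +contextual
    · intro a b _ _ h
      exact Sym.coe_injective (Multiset.map_injective Subtype.val_injective (add_right_cancel h))
    · rintro m ⟨hm, rfl⟩
      have hsub : m.toFinset.val ≤ m := Multiset.dedup_le m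
      have hmem : ∀ a ∈ m - m.toFinset.val, a ∈ m.toFinset := fun a ha => by
        simpa using Multiset.mem_of_le (Multiset.sub_le_self _ _) ha
      lift m - m.toFinset.val to Multiset m.toFinset using hmem with k hk
      refine ⟨⟨k, ?_⟩, Set.mem_univ _, ?_⟩
      · rw [← Multiset.card_map Subtype.val, hk, Multiset.card_sub hsub, hm]
        rfl
      · change k.map Subtype.val + _ = _
        rw [hk, tsub_add_cancel_of_le hsub]

theorem ncard_multiset_toFinset_card_eq {α : Type*} [Fintype α] [DecidableEq α] {p s : ℕ}
    (hp : 0 < p) (hs : 0 < s) :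
    {m : Multiset α | m.card = p ∧ m.toFinset.card = s}.ncard =
      (p - 1).choose (s - 1) * (Fintype.card α).choose s := by
  have hfin : {m : Multiset α | m.card = p ∧ m.toFinset.card = s}.Finite := by
    refine (Set.finite_range (fun m : Sym α p => (m : Multiset α))).subset ?_
    rintro m ⟨hm, -⟩
    exact ⟨⟨m, hm⟩, rfl⟩
  rw [Set.ncard_eq_toFinset_card _ hfin, Finset.card_eq_sum_card_fiberwise
    (f := Multiset.toFinset) (t := Finset.univ.powersetCard s)
    (by intro m hm; simpa using ((hfin.mem_toFinset).1 hm).2), mul_comm,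
    ← Finset.card_univ, ← Finset.card_powersetCard, ← smul_eq_mul, ← Finset.sum_const]
  refine Finset.sum_congr rfl fun S hS => ?_
  have hS : S.card = s := (Finset.mem_powersetCard.1 hS).2
  subst hS
  rw [← ncard_multiset_toFinset_eq hp hs, ← Set.ncard_coe_finset]
  congr 1
  ext m
  simp only [Finset.coe_filter, Set.Finite.mem_toFinset, Set.mem_ofPred_eq]
  constructor
  · rintro ⟨⟨h, -⟩, h'⟩
    exact ⟨h, h'⟩
  · rintro ⟨h, rfl⟩
    exact ⟨⟨h, rfl⟩, rfl⟩

theorem card_mul_ncard_multiset_prod_eq_one {G : Type*} [CommGroup G] [DecidableEq G]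
    {p s : ℕ} (h : (Nat.card G).Coprime p) :
    Nat.card G * {m : Multiset G | m.card = p ∧ m.toFinset.card = s ∧ m.prod = 1}.ncard =
      {m : Multiset G | m.card = p ∧ m.toFinset.card = s}.ncard := by
  have hmap : ∀ (g : G) (m : Multiset G), (m.map (g * ·)).card = m.card ∧
      (m.map (g * ·)).toFinset.card = m.toFinset.card ∧
      (m.map (g * ·)).prod = g ^ m.card * m.prod := by
    intro g m
    refine ⟨Multiset.card_map _ _, ?_, ?_⟩
    · rw [Multiset.toFinset_map, Finset.card_image_of_injective _ (mul_right_injective g)]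
    · rw [Multiset.prod_map_mul, Multiset.map_const', Multiset.prod_replicate, Multiset.map_id']
  rw [← Set.ncard_univ, ← Set.ncard_prod]
  refine Set.ncard_congr (fun x _ => x.2.map (x.1 * ·)) ?_ ?_ ?_
  · rintro ⟨g, m⟩ ⟨-, h1, h2, -⟩
    exact ⟨(hmap g m).1.trans h1, (hmap g m).2.1.trans h2⟩
  · rintro ⟨g, m⟩ ⟨g', m'⟩ ⟨-, h1, h2, h3⟩ ⟨-, h1', h2', h3'⟩ heq
    change m.map (g * ·) = m'.map (g' * ·) at heq
    change m.card = p at h1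
    change m.prod = 1 at h3
    change m'.card = p at h1'
    change m'.prod = 1 at h3'
    have hprod := congrArg Multiset.prod heq
    rw [(hmap g m).2.2, (hmap g' m').2.2, h1, h1', h3, h3', mul_one, mul_one] at hprod
    obtain rfl : g = g' := (powCoprime h).injective hprod
    exact Prod.ext rfl (Multiset.map_injective (mul_right_injective g) heq)
  · rintro m ⟨h1, h2⟩
    obtain ⟨g, hg⟩ := (powCoprime h).surjective m.prod
    replace hg : g ^ p = m.prod := hg
    refine ⟨(g, m.map (g⁻¹ * ·)), ⟨Set.mem_univ _, (hmap _ _).1.trans h1,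
      (hmap _ _).2.1.trans h2, ?_⟩, ?_⟩
    · rw [(hmap _ _).2.2, h1, ← hg, ← mul_pow, inv_mul_cancel, one_pow]
    · simp [Multiset.map_map]

theorem exists_univ_map_eq {β : Type*} {p : ℕ} {m : Multiset β} (hm : m.card = p) :
    ∃ d : Fin p → β, Finset.univ.val.map d = m := by
  obtain ⟨l, rfl⟩ := Quot.exists_rep m
  subst hm
  exact ⟨l.get, (Fin.univ_val_map _).trans (congrArg _ (List.ofFn_get l))⟩

/-- The multiset of eigenvalues of an element of `SU(p)`. -/
noncomputable def SU.eigenvalues {p : ℕ} (x : SU p) : Multiset ℂ :=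
  ((x : Matrix.unitaryGroup (Fin p) ℂ) : Matrix (Fin p) (Fin p) ℂ).charpoly.roots

namespace SU

variable {p : ℕ}

theorem card_eigenvalues (x : SU p) : (eigenvalues x).card = p := by
  rw [eigenvalues, IsAlgClosed.card_roots_eq_natDegree, charpoly_natDegree_eq_dim,
    Fintype.card_fin]

theorem prod_eigenvalues (x : SU p) : (eigenvalues x).prod = 1 :=
  (det_eq_prod_roots_charpoly _).symm.trans x.2

theorem mem_eigenvalues_iff (x : SU p) (a : ℂ) : a ∈ eigenvalues x ↔
    a ∈ spectrum ℂ ((x : Matrix.unitaryGroup (Fin p) ℂ) : Matrix (Fin p) (Fin p) ℂ) := by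
  rw [eigenvalues, mem_spectrum_iff_isRoot_charpoly,
    Polynomial.mem_roots (charpoly_monic _).ne_zero]

theorem pow_eq_one_of_mem_eigenvalues (hp : 0 < p) {x : SU p} {q : ℕ} (hx : x ^ q = 1) {a : ℂ}
    (ha : a ∈ eigenvalues x) : a ^ q = 1 := by
  have : Nonempty (Fin p) := ⟨⟨0, hp⟩⟩
  have hA : ((x : Matrix.unitaryGroup (Fin p) ℂ) : Matrix (Fin p) (Fin p) ℂ) ^ q = 1 := by
    simpa using congrArg (fun y : SU p => (y.1.1 : Matrix (Fin p) (Fin p) ℂ)) hx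
  have h := spectrum.pow_mem_pow _ q ((mem_eigenvalues_iff x a).1 ha)
  rwa [hA, spectrum.one_eq, Set.mem_singleton_iff] at h

open Classical in
theorem ncard_spectrum (x : SU p) :
    (spectrum ℂ ((x : Matrix.unitaryGroup (Fin p) ℂ) : Matrix (Fin p) (Fin p) ℂ)).ncard =
      (eigenvalues x).toFinset.card := by
  rw [← Set.ncard_coe_finset]
  congr 1
  ext a
  simp [mem_eigenvalues_iff]

theorem eigenvalues_eq_of_isConj {x y : SU p} (h : IsConj x y) :
    eigenvalues x = eigenvalues y := by
  obtain ⟨c, hc⟩ := isConj_iff.1 h.symm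
  rw [mul_inv_eq_iff_eq_mul] at hc
  rw [eigenvalues, eigenvalues, charpoly_eq_of_mul_eq_mul c.1
    (congrArg (fun z : SU p => (z.1.1 : Matrix (Fin p) (Fin p) ℂ)) hc).symm]

theorem isConj_of_eigenvalues_eq (hp : 0 < p) {x y : SU p} {q : ℕ} (hq : 0 < q) (hx : x ^ q = 1)
    (hy : y ^ q = 1) (h : eigenvalues x = eigenvalues y) : IsConj x y := by
  obtain ⟨d, hd⟩ := exists_univ_map_eq (card_eigenvalues x)
  obtain ⟨u, hu⟩ := exists_SU_mul_diagonal hp x.1 hq (congrArg Subtype.val hx) d hd.symm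
  obtain ⟨v, hv⟩ := exists_SU_mul_diagonal hp y.1 hq (congrArg Subtype.val hy) d
    (hd.trans h).symm
  have key : ∀ {z w : SU p}, z.1.1 * w.1.1 = w.1.1 * diagonal d →
      (w⁻¹ * z * w).1.1 = diagonal d := by
    intro z w hw
    change star w.1.1 * z.1.1 * w.1.1 = _
    rw [mul_assoc, hw, ← mul_assoc]
    have : star w.1.1 * w.1.1 = 1 := Unitary.coe_star_mul_self w.1
    rw [this, one_mul]
  have huv : u⁻¹ * x * u = v⁻¹ * y * v :=
    Subtype.ext (Subtype.ext ((key hu).trans (key hv).symm))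
  refine isConj_iff.2 ⟨v * u⁻¹, ?_⟩
  calc v * u⁻¹ * x * (v * u⁻¹)⁻¹ = v * (u⁻¹ * x * u) * v⁻¹ := by group
    _ = y := by rw [huv]; group

theorem exists_eigenvalues_eq {q : ℕ} (hq : 0 < q) {m : Multiset ℂ} (hm : m.card = p)
    (hmq : ∀ a ∈ m, a ^ q = 1) (hprod : m.prod = 1) :
    ∃ x : SU p, x ^ q = 1 ∧ eigenvalues x = m := by
  obtain ⟨d, rfl⟩ := exists_univ_map_eq hm
  have hd : ∀ i, d i ^ q = 1 := fun i => hmq _ (by simp)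
  have hun : diagonal d ∈ Matrix.unitaryGroup (Fin p) ℂ := by
    rw [mem_unitaryGroup_iff, star_eq_conjTranspose, diagonal_conjTranspose, diagonal_mul_diagonal,
      ← diagonal_one]
    congr 1
    funext i
    simp [Complex.mul_conj', Complex.norm_eq_one_of_pow_eq_one (hd i) hq.ne']
  refine ⟨⟨⟨diagonal d, hun⟩, ?_⟩, ?_, roots_charpoly_diagonal d⟩
  · change (diagonal d).det = 1
    rw [det_diagonal, ← hprod]
    rfl
  · refine Subtype.ext (Subtype.ext ?_)
    change diagonal d ^ q = 1
    rw [diagonal_pow, ← diagonal_one]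
    congr 1
    exact funext hd

end SU

open Classical in
theorem NSUs_eq_ncard_eigenvalues {p q s : ℕ} (hp : 0 < p) (hq : 0 < q) :
    NSUs p q s = {m : Multiset ℂ |
      m.card = p ∧ m.toFinset.card = s ∧ m.prod = 1 ∧ ∀ a ∈ m, a ^ q = 1}.ncard := by
  have hout : ∀ c : ConjClasses (SU p), c.out ∈ c.carrier := fun c =>
    ConjClasses.mem_carrier_iff_mk_eq.2 (Quotient.out_eq c)
  refine Set.ncard_congr (fun c _ => SU.eigenvalues c.out) ?_ ?_ ?_
  · intro c hc
    obtain ⟨h1, h2⟩ := hc _ (hout c)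
    exact ⟨SU.card_eigenvalues _, (SU.ncard_spectrum _).symm.trans h2, SU.prod_eigenvalues _,
      fun a => SU.pow_eq_one_of_mem_eigenvalues hp h1⟩
  · intro c c' hc hc' h
    rw [← Quotient.out_eq c, ← Quotient.out_eq c']
    exact Quotient.sound
      (SU.isConj_of_eigenvalues_eq hp hq (hc _ (hout c)).1 (hc' _ (hout c')).1 h)
  · rintro m ⟨h1, h2, h3, h4⟩
    obtain ⟨x, hx, rfl⟩ := SU.exists_eigenvalues_eq hq h1 h4 h3
    have hconj : ∀ y ∈ (ConjClasses.mk x).carrier, IsConj x y := fun y hy =>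
      (ConjClasses.mk_eq_mk_iff_isConj.1 (ConjClasses.mem_carrier_iff_mk_eq.1 hy)).symm
    refine ⟨ConjClasses.mk x, fun y hy => ⟨?_, ?_⟩,
      (SU.eigenvalues_eq_of_isConj (hconj _ (hout _))).symm⟩
    · obtain ⟨c, rfl⟩ := isConj_iff.1 (hconj y hy)
      rw [conj_pow, hx, mul_one, mul_inv_cancel]
    · rw [SU.ncard_spectrum, ← SU.eigenvalues_eq_of_isConj (hconj y hy), h2]

open Classical in
theorem NSUs_eq_ncard_multiset {p q s : ℕ} (hp : 0 < p) (hq : 0 < q) :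
    NSUs p q s = {m : Multiset (rootsOfUnity q ℂ) |
      m.card = p ∧ m.toFinset.card = s ∧ m.prod = 1}.ncard := by
  rw [NSUs_eq_ncard_eigenvalues hp hq]
  have := NeZero.of_pos hq
  let φ : rootsOfUnity q ℂ →* ℂ := (Units.coeHom ℂ).comp (rootsOfUnity q ℂ).subtype
  have hφ : Function.Injective φ := Units.val_injective.comp Subtype.val_injective
  have hcard : ∀ m : Multiset (rootsOfUnity q ℂ), (m.map φ).toFinset.card = m.toFinset.card :=
    fun m => by rw [Multiset.toFinset_map, Finset.card_image_of_injective _ hφ]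
  symm
  refine Set.ncard_congr (fun m _ => m.map φ) ?_ ?_ ?_
  · rintro m ⟨h1, h2, h3⟩
    refine ⟨(Multiset.card_map _ _).trans h1, (hcard m).trans h2, ?_, ?_⟩
    · rw [Multiset.prod_hom, h3, map_one]
    · intro a ha
      obtain ⟨z, -, rfl⟩ := Multiset.mem_map.1 ha
      rw [← map_pow, show z ^ q = 1 from Subtype.ext ((mem_rootsOfUnity q z.1).1 z.2), map_one]
  · exact fun a b _ _ h => Multiset.map_injective hφ h
  · rintro m ⟨h1, h2, h3, h4⟩
    obtain ⟨k, rfl⟩ : ∃ k : Multiset (rootsOfUnity q ℂ), k.map φ = m :=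
      ⟨m.pmap (fun a h => rootsOfUnity.mkOfPowEq a h) h4, by
        simp [φ, Multiset.map_pmap, Multiset.pmap_eq_map]⟩
    refine ⟨k, ⟨(Multiset.card_map _ _).symm.trans h1, (hcard k).symm.trans h2, ?_⟩, rfl⟩
    rw [Multiset.prod_hom] at h3
    exact hφ (h3.trans (map_one φ).symm)

/-- For coprime positive integers `p`, `q` and a positive integer `s`,
`q · N(SU(p), q, s) = C(p - 1, s - 1) · C(q, s)`. -/
theorem stmt_3 (p q s : ℕ) (hp : 0 < p) (hq : 0 < q) (hs : 0 < s) (hpq : Nat.gcd p q = 1) :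
    q * NSUs p q s = Nat.choose (p - 1) (s - 1) * Nat.choose q s := by
  classical
  have := NeZero.of_pos hq
  have := Fintype.ofFinite (rootsOfUnity q ℂ)
  have hcard : Nat.card (rootsOfUnity q ℂ) = q := Complex.card_rootsOfUnity q
  have h := card_mul_ncard_multiset_prod_eq_one (G := rootsOfUnity q ℂ) (p := p) (s := s)
    (by rw [hcard]; exact Nat.Coprime.symm hpq)
  rwa [← NSUs_eq_ncard_multiset hp hq, ncard_multiset_toFinset_card_eq hp hs,
    ← Nat.card_eq_fintype_card, hcard] at h
end

section
/- For any positive integers n and m, the number N(SU(n),m) of conjugacy classes of SU(n) consisting of elements x with x^m = 1 satisfies m · N(SU(n),m) = Σ_{d | gcd(n,m)} φ(d) · C(n/d + m/d - 1, n/d), where the sum is over positive divisors d of gcd(n,m) and φ is Euler's totient function. -/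
open Matrix

/-- `NSU p m` is the number of conjugacy classes of `SU(p)` all of whose elements `x`
satisfy `x ^ m = 1`. -/
noncomputable def NSU (p m : ℕ) : ℕ :=
  {c : ConjClasses (SU p) | ∀ x ∈ c.carrier, x ^ m = 1}.ncard

lemma exists_unitary_mul_diagonal_s6 {n m : ℕ} (hm : 0 < m) (x : unitaryGroup (Fin n) ℂ)
    (hx : x ^ m = 1) :
    ∃ (U : unitaryGroup (Fin n) ℂ) (μ : Fin n → ℂ), (∀ i, μ i ^ m = 1) ∧
      (x : Matrix (Fin n) (Fin n) ℂ) * U = U * diagonal μ := by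
  classical
  set A : Matrix (Fin n) (Fin n) ℂ := (x : Matrix (Fin n) (Fin n) ℂ) with hA
  set T : Module.End ℂ (EuclideanSpace ℂ (Fin n)) := Matrix.toLpLin 2 2 A with hT
  have hAm : A ^ m = 1 := by simpa using congrArg Subtype.val hx
  have hTm : T ^ m = 1 := by
    rw [hT, ← Matrix.toLpLin_pow, hAm, Matrix.toLpLin_one]; rfl
  have hss : T.IsSemisimple := by
    refine Module.End.isSemisimple_of_squarefree_aeval_eq_zero
      (p := Polynomial.X ^ m - Polynomial.C 1) ?_ ?_
    · exact (Polynomial.separable_X_pow_sub_C (1 : ℂ) (by exact_mod_cast hm.ne')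
        one_ne_zero).squarefree
    · simp [hTm]
  have hinner (v w : EuclideanSpace ℂ (Fin n)) : inner ℂ (T v) (T w) = inner ℂ v w := by
    rw [EuclideanSpace.inner_eq_star_dotProduct, EuclideanSpace.inner_eq_star_dotProduct,
      dotProduct_comm, dotProduct_comm w.ofLp]
    simp only [hT, Matrix.toLpLin_apply]
    rw [star_mulVec, dotProduct_mulVec, vecMul_vecMul, ← star_eq_conjTranspose,
      UnitaryGroup.star_mul_self, vecMul_one]
  have horth : OrthogonalFamily ℂ (fun μ : T.Eigenvalues => T.eigenspace μ)
      fun μ => (T.eigenspace μ).subtypeₗᵢ := by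
    rintro ⟨a, ha⟩ ⟨b, hb⟩ hab ⟨v, hv⟩ ⟨w, hw⟩
    change inner ℂ v w = 0
    have hv' : T v = a • v := Module.End.mem_eigenspace_iff.mp hv
    have hw' : T w = b • w := Module.End.mem_eigenspace_iff.mp hw
    by_cases hv0 : v = 0
    · simp [hv0]
    have h1 := hinner v v
    have h2 := hinner v w
    rw [hv', inner_smul_left, inner_smul_right, ← mul_assoc,
      mul_eq_right₀ (by simpa using hv0)] at h1
    rw [hv', hw', inner_smul_left, inner_smul_right, ← mul_assoc] at h2
    by_contra h
    rw [mul_eq_right₀ h] at h2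
    have h0 : (starRingEnd ℂ) a ≠ 0 := left_ne_zero_of_mul_eq_one h1
    exact hab (Subtype.ext (mul_left_cancel₀ h0 (h1.trans h2.symm)))
  have hint : DirectSum.IsInternal fun μ : T.Eigenvalues => T.eigenspace μ := by
    rw [horth.isInternal_iff]
    have : ⨆ μ : T.Eigenvalues, T.eigenspace μ = ⊤ := by
      rw [← hss.iSup_eigenspace_eq_top]
      exact iSup_ne_bot_subtype _
    rw [this, Submodule.top_orthogonal_eq_bot]
  have hfr : Module.finrank ℂ (EuclideanSpace ℂ (Fin n)) = n := by simp
  let b := hint.subordinateOrthonormalBasis hfr horth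
  let μ : Fin n → ℂ := fun i => (hint.subordinateOrthonormalBasisIndex hfr i horth : T.Eigenvalues)
  have hb (i : Fin n) : T (b i) = μ i • b i :=
    Module.End.mem_eigenspace_iff.mp (hint.subordinateOrthonormalBasis_subordinate hfr i horth)
  refine ⟨⟨_, (EuclideanSpace.basisFun (Fin n) ℂ).toMatrix_orthonormalBasis_mem_unitary b⟩, μ,
    fun i => ?_, ?_⟩
  · have h (k : ℕ) : (T ^ k) (b i) = μ i ^ k • b i := by
      induction k with
      | zero => simp
      | succ k ih => rw [pow_succ', Module.End.mul_apply, ih, map_smul, hb, smul_smul, pow_succ]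
    have h1 := h m
    rw [hTm, Module.End.one_apply, eq_comm] at h1
    have hb0 : b i ≠ 0 := b.orthonormal.ne_zero i
    exact smul_left_injective ℂ hb0 (h1.trans (one_smul ℂ _).symm)
  · ext i j
    have := congrArg (fun v => v i) (hb j)
    rw [Matrix.mul_diagonal, Matrix.mul_apply]
    simpa [hT, Matrix.toLpLin_apply, Matrix.mulVec, dotProduct, Module.Basis.toMatrix_apply,
      mul_comm] using this

lemma exists_equiv_comp_of_map_eq {ι α : Type*} [Fintype ι] {f g : ι → α}
    (h : Finset.univ.val.map f = Finset.univ.val.map g) : ∃ σ : Equiv.Perm ι, f ∘ σ = g := by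
  classical
  have hcard (a : α) : Nonempty ({i // g i = a} ≃ {i // f i = a}) := by
    rw [← Fintype.card_eq]
    have := congrArg (Multiset.count a) h
    simp only [Multiset.count_map, eq_comm (a := a)] at this
    rw [Fintype.card_subtype, Fintype.card_subtype]
    exact this.symm
  let e := fun a => (hcard a).some
  exact ⟨Equiv.ofFiberEquiv e, funext fun i => Equiv.ofFiberEquiv_map e i⟩

lemma roots_prod_univ_X_sub_C {ι R : Type*} [Fintype ι] [CommRing R] [IsDomain R] (d : ι → R) :
    (∏ i, (Polynomial.X - Polynomial.C (d i))).roots = Finset.univ.val.map d := by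
  rw [← Polynomial.roots_multiset_prod_X_sub_C (Finset.univ.val.map d), Multiset.map_map]
  rfl

lemma stdAddChar_sum {ι : Type*} {m : ℕ} [NeZero m] (s : Finset ι) (f : ι → ZMod m) :
    (ZMod.stdAddChar (∑ i ∈ s, f i) : ℂ) = ∏ i ∈ s, (ZMod.stdAddChar (f i) : ℂ) :=
  map_prod (ZMod.stdAddChar (N := m)).toMonoidHom (fun i => Multiplicative.ofAdd (f i)) s

lemma SU.isConj_of_unitary_mul_eq {n : ℕ} (hn : 0 < n) {x y : SU n} (V : unitaryGroup (Fin n) ℂ)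
    (h : (x : unitaryGroup (Fin n) ℂ) * V = V * y) : IsConj x y := by
  set δ : ℂ := (V : Matrix (Fin n) (Fin n) ℂ).det with hδ
  have hδ1 : ‖δ‖ = 1 := CStarRing.norm_of_mem_unitary (det_of_mem_unitary V.2)
  have hδ0 : δ ≠ 0 := by rw [← norm_ne_zero_iff, hδ1]; exact one_ne_zero
  obtain ⟨c, hc⟩ := IsAlgClosed.exists_pow_nat_eq δ⁻¹ hn
  have hc1 : ‖c‖ = 1 := by
    rw [← pow_eq_one_iff_of_nonneg (norm_nonneg c) hn.ne', ← norm_pow, hc, norm_inv, hδ1, inv_one]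
  have hcc : star c * c = 1 := by
    rw [Complex.star_def, Complex.conj_mul', hc1]; simp
  have hV : star (V : Matrix (Fin n) (Fin n) ℂ) * V = 1 := UnitaryGroup.star_mul_self V
  let W : unitaryGroup (Fin n) ℂ := ⟨c • (V : Matrix (Fin n) (Fin n) ℂ), by
    rw [mem_unitaryGroup_iff', star_smul, smul_mul_smul_comm, hV, hcc, one_smul]⟩
  have hW : W ∈ SU n := by
    change (c • (V : Matrix (Fin n) (Fin n) ℂ)).det = 1
    rw [det_smul, Fintype.card_fin, hc, ← hδ, inv_mul_cancel₀ hδ0]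
  rw [isConj_comm, isConj_iff]
  refine ⟨⟨W, hW⟩, ?_⟩
  rw [mul_inv_eq_iff_eq_mul]
  have h' := congrArg Subtype.val h
  apply Subtype.ext
  apply Subtype.ext
  change (c • (V : Matrix (Fin n) (Fin n) ℂ)) * (y : unitaryGroup (Fin n) ℂ).1 =
    (x : unitaryGroup (Fin n) ℂ).1 * (c • (V : Matrix (Fin n) (Fin n) ℂ))
  rw [smul_mul_assoc, mul_smul_comm]
  exact congrArg (c • ·) h'.symm

/-- The diagonal element of `SU n` whose entries are the `m`-th roots of unity with exponents
given by a family in `ZMod m` of sum zero. -/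
noncomputable def SU.diag {n m : ℕ} [NeZero m] (f : Fin n → ZMod m) (hf : ∑ i, f i = 0) : SU n :=
  ⟨⟨diagonal fun i => (ZMod.stdAddChar (f i) : ℂ), by
    rw [mem_unitaryGroup_iff', star_eq_conjTranspose, diagonal_conjTranspose, diagonal_mul_diagonal,
      ← diagonal_one]
    congr 1
    funext i
    rw [Pi.star_apply, Complex.star_def, Complex.conj_mul', AddChar.norm_apply]
    simp⟩, by
    change (diagonal fun i => (ZMod.stdAddChar (f i) : ℂ)).det = 1
    rw [det_diagonal]
    rw [← stdAddChar_sum, hf, AddChar.map_zero_eq_one]⟩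

lemma SU.coe_diag {n m : ℕ} [NeZero m] (f : Fin n → ZMod m) (hf : ∑ i, f i = 0) :
    ((SU.diag f hf : unitaryGroup (Fin n) ℂ) : Matrix (Fin n) (Fin n) ℂ) =
      diagonal fun i => (ZMod.stdAddChar (f i) : ℂ) := rfl

lemma SU.diag_pow {n m : ℕ} [NeZero m] (f : Fin n → ZMod m) (hf : ∑ i, f i = 0) :
    SU.diag f hf ^ m = 1 := by
  apply Subtype.ext
  apply Subtype.ext
  simp only [SubmonoidClass.coe_pow, SU.coe_diag, diagonal_pow, OneMemClass.coe_one]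
  rw [← diagonal_one]
  congr 1
  funext i
  simp [← AddChar.map_nsmul_eq_pow]

lemma SU.isConj_diag_of_map_eq {n m : ℕ} [NeZero m] (hn : 0 < n) {f g : Fin n → ZMod m}
    (hf : ∑ i, f i = 0) (hg : ∑ i, g i = 0)
    (h : Finset.univ.val.map f = Finset.univ.val.map g) :
    IsConj (SU.diag f hf) (SU.diag g hg) := by
  obtain ⟨σ, rfl⟩ := exists_equiv_comp_of_map_eq h.symm
  have hP : σ.permMatrix ℂ ∈ unitaryGroup (Fin n) ℂ := by
    rw [mem_unitaryGroup_iff', star_eq_conjTranspose, conjTranspose_permMatrix, ← permMatrix_mul,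
      mul_inv_cancel, permMatrix_one]
  refine SU.isConj_of_unitary_mul_eq hn ⟨_, hP⟩ ?_
  apply Subtype.ext
  simp only [UnitaryGroup.mul_val, SU.coe_diag]
  ext i j
  rw [diagonal_mul, mul_diagonal]
  simp only [PEquiv.toMatrix_apply, Equiv.toPEquiv_apply, Function.comp_apply, Option.mem_some_iff]
  split_ifs with h
  · rw [h, mul_comm]
  · simp

lemma SU.map_eq_of_isConj_diag {n m : ℕ} [NeZero m] {f g : Fin n → ZMod m}
    {hf : ∑ i, f i = 0} {hg : ∑ i, g i = 0} (h : IsConj (SU.diag f hf) (SU.diag g hg)) :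
    Finset.univ.val.map f = Finset.univ.val.map g := by
  obtain ⟨c, hc⟩ := isConj_iff.mp h
  have hc' := congrArg
    (fun x : SU n => ((x : unitaryGroup (Fin n) ℂ) : Matrix (Fin n) (Fin n) ℂ)) hc
  let M : (Matrix (Fin n) (Fin n) ℂ)ˣ := Unitary.toUnits (c : unitaryGroup (Fin n) ℂ)
  have hM : (M : Matrix (Fin n) (Fin n) ℂ) * (diagonal fun i => (ZMod.stdAddChar (f i) : ℂ)) *
      (M⁻¹ : (Matrix (Fin n) (Fin n) ℂ)ˣ) = diagonal fun i => (ZMod.stdAddChar (g i) : ℂ) := hc'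
  rw [coe_units_inv] at hM
  have h1 := congrArg (fun A => A.charpoly.roots) hM
  simp only [charpoly_units_conj, charpoly_diagonal] at h1
  rw [roots_prod_univ_X_sub_C, roots_prod_univ_X_sub_C] at h1
  apply Multiset.map_injective (ZMod.injective_stdAddChar (N := m))
  rw [Multiset.map_map, Multiset.map_map]
  exact h1

lemma SU.exists_isConj_diag {n m : ℕ} [NeZero m] (hn : 0 < n) (x : SU n) (hx : x ^ m = 1) :
    ∃ (g : Fin n → ZMod m) (hg : ∑ i, g i = 0), IsConj x (SU.diag g hg) := by
  obtain ⟨U, μ, hμ, hU⟩ := exists_unitary_mul_diagonal_s6 (NeZero.pos m) (x : unitaryGroup (Fin n) ℂ)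
    (by simpa using congrArg Subtype.val hx)
  have hω : IsPrimitiveRoot (ZMod.stdAddChar (1 : ZMod m) : ℂ) m := by
    rw [IsPrimitiveRoot.iff_orderOf]
    exact (orderOf_injective (ZMod.stdAddChar (N := m)).toMonoidHom
      (fun a b h => ZMod.injective_stdAddChar h) (Multiplicative.ofAdd 1)).trans
        (ZMod.addOrderOf_one m)
  have hex (i : Fin n) : ∃ k : ZMod m, (ZMod.stdAddChar k : ℂ) = μ i := by
    obtain ⟨k, -, hk⟩ := hω.eq_pow_of_pow_eq_one (hμ i)
    exact ⟨k • 1, by rw [AddChar.map_nsmul_eq_pow, hk]⟩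
  choose g hg using hex
  obtain rfl : μ = fun i => (ZMod.stdAddChar (g i) : ℂ) := funext fun i => (hg i).symm
  have hU0 : (U : Matrix (Fin n) (Fin n) ℂ).det ≠ 0 := by
    have h : (U : Matrix (Fin n) (Fin n) ℂ) * star (U : Matrix (Fin n) (Fin n) ℂ) = 1 :=
      mem_unitaryGroup_iff.mp U.2
    exact det_ne_zero_of_right_inverse h
  have hdet := congrArg Matrix.det hU
  have hx1 : ((x : unitaryGroup (Fin n) ℂ) : Matrix (Fin n) (Fin n) ℂ).det = 1 := x.2
  rw [det_mul, det_mul, hx1, one_mul, eq_comm, mul_eq_left₀ hU0, det_diagonal] at hdet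
  have hsum : ∑ i, g i = 0 := by
    rw [← stdAddChar_sum] at hdet
    exact ZMod.injective_stdAddChar (hdet.trans (AddChar.map_zero_eq_one _).symm)
  exact ⟨g, hsum, SU.isConj_of_unitary_mul_eq hn U (Subtype.ext hU)⟩

lemma NSU_eq_card (n m : ℕ) [NeZero m] (hn : 0 < n) :
    NSU n m = ((Finset.univ.finsuppAntidiag n).filter
        fun l : ZMod m →₀ ℕ => ∑ k, l k • k = 0).card := by
  have hsum (s : Multiset (ZMod m)) : ∑ k, s.toFinsupp k • k = s.sum := by
    rw [Finset.sum_multiset_count_of_subset s Finset.univ (Finset.subset_univ _)]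
    simp
  have hex : ∀ l ∈ (Finset.univ.finsuppAntidiag n).filter
      (fun l : ZMod m →₀ ℕ => ∑ k, l k • k = 0), ∃ (f : Fin n → ZMod m) (_ : ∑ i, f i = 0),
        (Finset.univ.val.map f).toFinsupp = l := by
    intro l hl
    obtain ⟨s, rfl⟩ := Multiset.toFinsupp.surjective l
    rw [Finset.mem_filter, Finset.mem_finsuppAntidiag, hsum] at hl
    obtain ⟨⟨hcard, -⟩, hs⟩ := hl
    have hcard : s.card = n := by
      rw [← hcard, ← Multiset.sum_count_eq_card (s := Finset.univ) (by simp)]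
      exact Finset.sum_congr rfl fun _ _ => (Multiset.toFinsupp_apply _ _).symm
    obtain ⟨v, rfl⟩ : ∃ v : List (ZMod m), (v : Multiset (ZMod m)) = s := ⟨s.toList, by simp⟩
    obtain rfl : v.length = n := hcard
    have hv : Finset.univ.val.map v.get = (v : Multiset (ZMod m)) := by
      simp [Fin.univ_val_map]
    exact ⟨v.get, by rw [Finset.sum_eq_multiset_sum, hv, hs], by rw [hv]⟩
  choose f hf hfl using hex
  rw [← Set.ncard_coe_finset]
  symm
  refine Set.ncard_congr (fun l hl => ConjClasses.mk (SU.diag (f l hl) (hf l hl))) ?_ ?_ ?_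
  · intro l hl x hx
    rw [ConjClasses.mem_carrier_iff_mk_eq, ConjClasses.mk_eq_mk_iff_isConj, isConj_comm] at hx
    obtain ⟨c, rfl⟩ := isConj_iff.mp hx
    rw [conj_pow, SU.diag_pow, mul_one, mul_inv_cancel]
  · intro l l' hl hl' h
    rw [← hfl l hl, ← hfl l' hl',
      SU.map_eq_of_isConj_diag (ConjClasses.mk_eq_mk_iff_isConj.mp h)]
  · intro c hc
    obtain ⟨x, rfl⟩ := ConjClasses.exists_rep c
    obtain ⟨g, hg, hxg⟩ := SU.exists_isConj_diag hn x (hc x ConjClasses.mem_carrier_mk)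
    have hl : (Finset.univ.val.map g).toFinsupp ∈ (Finset.univ.finsuppAntidiag n).filter
        (fun l : ZMod m →₀ ℕ => ∑ k, l k • k = 0) := by
      rw [Finset.mem_filter, Finset.mem_finsuppAntidiag, hsum]
      refine ⟨⟨?_, Finset.subset_univ _⟩, hg⟩
      have := Multiset.sum_count_eq_card (s := Finset.univ) (m := Finset.univ.val.map g) (by simp)
      simpa using this
    refine ⟨_, hl, ?_⟩
    rw [ConjClasses.mk_eq_mk_iff_isConj]
    exact (SU.isConj_diag_of_map_eq hn _ hg (Multiset.toFinsupp.injective (hfl _ hl))).trans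
      hxg.symm

open PowerSeries in
lemma prod_one_sub_pow_mul_X {ω : ℂ} {d : ℕ} (hd : 0 < d) (hω : IsPrimitiveRoot ω d) :
    ∏ k ∈ Finset.range d, (1 - C (ω ^ k) * X : ℂ⟦X⟧) = 1 - X ^ d := by
  have hω' : IsPrimitiveRoot (C ω : ℂ⟦X⟧) d := hω.map_of_injective PowerSeries.C_injective
  classical
  have h := hω'.pow_sub_pow_eq_prod_sub_mul 1 X hd
  rw [one_pow] at h
  rw [h, Finset.prod_eq_multiset_prod (Polynomial.nthRootsFinset d 1),
    Polynomial.nthRootsFinset_def, Multiset.toFinset_val, hω'.nthRoots_one_nodup.dedup,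
    hω'.nthRoots_eq (one_pow d), Multiset.map_map, Finset.prod_eq_multiset_prod, Finset.range_val]
  simp

open PowerSeries in
lemma prod_range_mul_one_sub_pow_mul_X {ω : ℂ} {d : ℕ} (hd : 0 < d) (hω : IsPrimitiveRoot ω d)
    (q : ℕ) :
    ∏ k ∈ Finset.range (d * q), (1 - C (ω ^ k) * X : ℂ⟦X⟧) = (1 - X ^ d) ^ q := by
  induction q with
  | zero => simp
  | succ q ih =>
    rw [mul_add_one, Finset.prod_range_add, ih, pow_succ, ← prod_one_sub_pow_mul_X hd hω]
    simp [pow_add, pow_mul, hω.pow_eq_one]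

open PowerSeries in
lemma mk_pow_mul_one_sub (a : ℂ) : (mk fun r => a ^ r) * (1 - C a * X) = 1 := by
  have := congrArg (rescale a) (mk_one_mul_one_sub_eq_one ℂ)
  simpa [rescale_mk, rescale_X] using this

open PowerSeries in
lemma mk_choose_mul (d q : ℕ) (hd : 0 < d) (hq : 0 < q) :
    (mk fun n => if d ∣ n then ((n / d + q - 1).choose (n / d) : ℂ) else 0) * (1 - X ^ d) ^ q
      = 1 := by
  obtain ⟨q, rfl⟩ := Nat.exists_eq_succ_of_ne_zero hq.ne'
  have := congrArg (expand d hd.ne') (mk_add_choose_mul_one_sub_pow_eq_one ℂ q)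
  simp only [map_mul, map_pow, map_sub, map_one, expand_X] at this
  convert this using 2
  ext n
  simp only [coeff_expand, coeff_mk]
  split_ifs with h
  · congr 1
    rw [show n / d + q.succ - 1 = q + n / d by rw [Nat.succ_eq_add_one]; lia, Nat.choose_symm_add]
  · rfl

lemma ZMod.prod_val {M : Type*} [CommMonoid M] (m : ℕ) [NeZero m] (f : ℕ → M) :
    ∏ k : ZMod m, f k.val = ∏ k ∈ Finset.range m, f k := by
  obtain ⟨m, rfl⟩ := Nat.exists_eq_succ_of_ne_zero (NeZero.ne m)
  exact Fin.prod_univ_eq_prod_range f (m + 1)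

open PowerSeries in
lemma coeff_prod_char (n m : ℕ) [NeZero m] (j : ZMod m) :
    coeff n (∏ k : ZMod m, (mk fun r => (ZMod.stdAddChar (j * k) : ℂ) ^ r)) =
      if addOrderOf j ∣ n then
        ((n / addOrderOf j + m / addOrderOf j - 1).choose (n / addOrderOf j) : ℂ) else 0 := by
  set d := addOrderOf j with hdj
  have hd : 0 < d := addOrderOf_pos j
  have hdm : d ∣ m := by simpa using addOrderOf_dvd_card (x := j)
  have hq : 0 < m / d := Nat.div_pos (Nat.le_of_dvd (NeZero.pos m) hdm) hd
  have hω : IsPrimitiveRoot (ZMod.stdAddChar j : ℂ) d := by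
    rw [IsPrimitiveRoot.iff_orderOf]
    exact orderOf_injective (ZMod.stdAddChar (N := m)).toMonoidHom
      (fun a b h => ZMod.injective_stdAddChar h) (Multiplicative.ofAdd j)
  have hval (k : ZMod m) : (ZMod.stdAddChar (j * k) : ℂ) = (ZMod.stdAddChar j) ^ k.val := by
    rw [← AddChar.map_nsmul_eq_pow, nsmul_eq_mul, ZMod.natCast_zmod_val, mul_comm]
  have h1 : (∏ k : ZMod m, (mk fun r => (ZMod.stdAddChar (j * k) : ℂ) ^ r)) *
      (1 - X ^ d) ^ (m / d) = 1 := by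
    rw [← prod_range_mul_one_sub_pow_mul_X hd hω, Nat.mul_div_cancel' hdm, ← ZMod.prod_val,
      ← Finset.prod_mul_distrib]
    refine Finset.prod_eq_one fun k _ => ?_
    rw [← hval, mk_pow_mul_one_sub]
  have h2 := mk_choose_mul d (m / d) hd hq
  have := mul_right_cancel₀ (right_ne_zero_of_mul_eq_one h1) (h1.trans h2.symm)
  rw [this, coeff_mk]

lemma mul_card_zeroSum (n m : ℕ) [NeZero m] (hn : 0 < n) :
    m * ((Finset.univ.finsuppAntidiag n).filter
        fun l : ZMod m →₀ ℕ => ∑ k, l k • k = 0).card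
      = ∑ d ∈ (Nat.gcd n m).divisors,
          Nat.totient d * Nat.choose (n / d + m / d - 1) (n / d) := by
  have key : (m : ℂ) * ((Finset.univ.finsuppAntidiag n).filter
        fun l : ZMod m →₀ ℕ => ∑ k, l k • k = 0).card =
      ∑ j : ZMod m, if addOrderOf j ∣ n then
        ((n / addOrderOf j + m / addOrderOf j - 1).choose (n / addOrderOf j) : ℂ) else 0 := by
    simp_rw [← coeff_prod_char, PowerSeries.coeff_prod, PowerSeries.coeff_mk]
    rw [Finset.sum_comm, Finset.card_filter, Nat.cast_sum, Finset.mul_sum]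
    refine Finset.sum_congr rfl fun l _ => ?_
    have h (j : ZMod m) : ∏ k, (ZMod.stdAddChar (j * k) : ℂ) ^ l k =
        ZMod.stdAddChar (j * ∑ k, l k • k) := by
      simp only [← AddChar.map_nsmul_eq_pow, Finset.mul_sum, mul_smul_comm]
      exact (map_prod (ZMod.stdAddChar (N := m)).toMonoidHom
        (fun k => Multiplicative.ofAdd (l k • (j * k))) Finset.univ).symm
    simp_rw [h]
    rw [AddChar.sum_mulShift _ (ZMod.isPrimitive_stdAddChar m)]
    split_ifs <;> simp
  have h2 : ∑ j : ZMod m, (if addOrderOf j ∣ n then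
        (n / addOrderOf j + m / addOrderOf j - 1).choose (n / addOrderOf j) else 0) =
      ∑ d ∈ (Nat.gcd n m).divisors,
          Nat.totient d * Nat.choose (n / d + m / d - 1) (n / d) := by
    rw [← Finset.sum_filter, ← Finset.sum_fiberwise_of_maps_to (g := addOrderOf)
      (t := (Nat.gcd n m).divisors)]
    · refine Finset.sum_congr rfl fun d hd => ?_
      have hd' := Nat.dvd_of_mem_divisors hd
      rw [← IsAddCyclic.card_addOrderOf_eq_totient (α := ZMod m)
        (by simpa using hd'.trans (Nat.gcd_dvd_right _ _)), ← smul_eq_mul, ← Finset.sum_const,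
        Finset.filter_filter]
      refine Finset.sum_congr ?_ ?_
      · ext j
        simp only [Finset.mem_filter, Finset.mem_univ, true_and, and_iff_right_iff_imp]
        rintro rfl
        exact hd'.trans (Nat.gcd_dvd_left _ _)
      · intro j hj
        simp only [Finset.mem_filter, Finset.mem_univ, true_and] at hj
        rw [hj]
    · intro j hj
      simp only [Finset.mem_filter, Finset.mem_univ, true_and] at hj
      rw [Nat.mem_divisors]
      refine ⟨Nat.dvd_gcd hj ?_, (Nat.gcd_pos_of_pos_left _ hn).ne'⟩
      simpa using addOrderOf_dvd_card (x := j)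
  rw [← h2]
  exact_mod_cast key

/-- For any positive integers `n` and `m`,
`m · N(SU(n), m) = Σ_{d | gcd(n,m)} φ(d) · C(n/d + m/d - 1, n/d)`. -/
theorem stmt_6 (n m : ℕ) (hn : 0 < n) (hm : 0 < m) :
    m * NSU n m
      = ∑ d ∈ (Nat.gcd n m).divisors,
          Nat.totient d * Nat.choose (n / d + m / d - 1) (n / d) := by
  have : NeZero m := ⟨hm.ne'⟩
  rw [NSU_eq_card n m hn, mul_card_zeroSum n m hn]
end

section
/- For positive integers p, q, s with gcd(p,q) = 1, the following identity of integers holds: p · Σ_{j=0}^{p} (-1)^{j+s} · C(p+q-j-1, p-j) · C(q, j) · C(j, s) = s · C(p, s) · C(q, s). -/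
open Matrix

theorem Ring.choose_neg_natCast (d n : ℕ) :
    Ring.choose (-(d : ℤ)) n = (-1) ^ n * (d.multichoose n : ℤ) := by
  have h : Ring.multichoose (d : ℤ) n = (d.multichoose n : ℤ) := by
    rw [Nat.multichoose_eq]
    rfl
  rw [Ring.choose_neg', h, Int.negOnePow_def, zpow_natCast, Units.smul_def]
  simp

theorem Int.alternating_sum_range_choose_mul_multichoose (m s n : ℕ) :
    ∑ i ∈ Finset.range (n + 1),
        (-1) ^ i * (m.choose i : ℤ) * ((m + s).multichoose (n - i) : ℤ) =
      s.multichoose n := by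
  have h := Ring.add_choose_eq n (Commute.all (m : ℤ) (-((m + s : ℕ) : ℤ)))
  rw [show (m : ℤ) + -((m + s : ℕ) : ℤ) = -(s : ℤ) by push_cast; ring,
    Ring.choose_neg_natCast, Finset.Nat.sum_antidiagonal_eq_sum_range_succ_mk] at h
  have sq : ∀ k : ℕ, ((-1 : ℤ) ^ k) * (-1) ^ k = 1 := fun k => by
    rw [← pow_add, Even.neg_one_pow (Even.add_self k)]
  have h' : (s.multichoose n : ℤ) = (-1) ^ n * ((-1) ^ n * s.multichoose n) := by
    rw [← mul_assoc, sq, one_mul]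
  rw [h', h, Finset.mul_sum]
  refine Finset.sum_congr rfl fun i hi => ?_
  obtain ⟨k, rfl⟩ := Nat.exists_eq_add_of_le (Finset.mem_range_succ_iff.mp hi)
  simp only [Ring.choose_natCast, Ring.choose_neg_natCast, Nat.add_sub_cancel_left]
  rw [pow_add]
  linear_combination (-(-1) ^ i * (m.choose i : ℤ) * ((m + s).multichoose k : ℤ)) * sq k

/-- For coprime positive integers `p`, `q` and a positive integer `s`, the integer identity
`p · Σ_{j=0}^{p} (-1)^(j+s) · C(p+q-j-1, p-j) · C(q, j) · C(j, s) = s · C(p, s) · C(q, s)`. -/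
theorem stmt_7 (p q s : ℕ) (hp : 0 < p) (hq : 0 < q) (hs : 0 < s) (hpq : Nat.gcd p q = 1) :
    (p : ℤ) * ∑ j ∈ Finset.range (p + 1),
        (-1) ^ (j + s) * (Nat.choose (p + q - j - 1) (p - j) : ℤ) *
          (Nat.choose q j : ℤ) * (Nat.choose j s : ℤ)
      = (s : ℤ) * (Nat.choose p s : ℤ) * (Nat.choose q s : ℤ) := by
  rcases lt_or_ge q s with hqs | hsq
  · rw [Finset.sum_eq_zero, Nat.choose_eq_zero_of_lt hqs]
    · simp
    · intro j _
      rcases lt_or_ge q j with hqj | hjq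
      · simp [Nat.choose_eq_zero_of_lt hqj]
      · simp [Nat.choose_eq_zero_of_lt (hjq.trans_lt hqs)]
  rcases lt_or_ge p s with hps | hsp
  · rw [Finset.sum_eq_zero, Nat.choose_eq_zero_of_lt hps]
    · simp
    · intro j hj
      simp [Nat.choose_eq_zero_of_lt ((Finset.mem_range_succ_iff.mp hj).trans_lt hps)]
  obtain ⟨n, rfl⟩ := Nat.exists_eq_add_of_le hsp
  obtain ⟨m, rfl⟩ := Nat.exists_eq_add_of_le hsq
  have hlow : ∑ j ∈ Finset.range s, (-1) ^ (j + s) *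
      (Nat.choose (s + n + (s + m) - j - 1) (s + n - j) : ℤ) *
      (Nat.choose (s + m) j : ℤ) * (Nat.choose j s : ℤ) = 0 :=
    Finset.sum_eq_zero fun j hj => by simp [Nat.choose_eq_zero_of_lt (Finset.mem_range.mp hj)]
  have hhigh : ∑ i ∈ Finset.range (n + 1), (-1) ^ (s + i + s) *
      (Nat.choose (s + n + (s + m) - (s + i) - 1) (s + n - (s + i)) : ℤ) *
      (Nat.choose (s + m) (s + i) : ℤ) * (Nat.choose (s + i) s : ℤ) =
      Nat.choose (s + m) s * s.multichoose n := by
    rw [← Int.alternating_sum_range_choose_mul_multichoose m s n, Finset.mul_sum]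
    refine Finset.sum_congr rfl fun i hi => ?_
    have hin := Finset.mem_range_succ_iff.mp hi
    have hc : ((s + m).choose (s + i) : ℤ) * ((s + i).choose s : ℤ) =
        (s + m).choose s * m.choose i := by
      have := Nat.choose_mul (n := s + m) (Nat.le_add_right s i)
      simp only [Nat.add_sub_cancel_left] at this
      exact_mod_cast this
    have hsign : (-1 : ℤ) ^ (s + i + s) = (-1) ^ i := by
      rw [show s + i + s = s + s + i by ring, pow_add, Even.neg_one_pow (Even.add_self s), one_mul]
    rw [hsign, mul_assoc, hc, Nat.multichoose_eq,
      show s + n + (s + m) - (s + i) - 1 = m + s + (n - i) - 1 by lia,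
      Nat.add_sub_add_left]
    ring
  have habs : ((s + n : ℕ) : ℤ) * s.multichoose n = s * (s + n).choose s := by
    obtain ⟨t, rfl⟩ := Nat.exists_eq_succ_of_ne_zero hs.ne'
    have h := Nat.add_one_mul_choose_eq (t + n) t
    rw [Nat.multichoose_eq, show t.succ + n - 1 = t + n by lia, ← Nat.choose_symm_add,
      show t.succ + n = t + n + 1 by lia, mul_comm (t.succ : ℤ)]
    exact_mod_cast h
  rw [add_assoc s n 1, Finset.sum_range_add, hlow, zero_add, hhigh]
  linear_combination ((s + m).choose s : ℤ) * habs
end
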